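/- (Kostant's relation for the McKay operator, B v_n = v_{n−1} + v_{n+1}.) Let G be a finite group, φ : G →* SL(2,ℂ) a homomorphism, and for n ∈ ℕ let c_n : G → ℂ be the class function c_n(g) = p_n(φ(g)) (the character of the restriction of the n-th symmetric power representation π_n of SL(2,ℂ) to G). Let (ρ_i)_{i∈ι} be a finite family of pairwise non-isomorphic irreducible finite-dimensional complex representations of G such that every irreducible finite-dimensional complex representation of G is isomorphic to some ρ_i, with characters χ_i. Define the McKay matrix A by A i j = ⟨c₁ · χ_j, χ_i⟩ and multiplicities m_i(n) = ⟨c_n, χ_i⟩. Then for all n ≥ 1 and all i ∈ ι: Σ_{j∈ι} A i j · m_j(n) = m_i(n−1) + m_i(n+1). -/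

import Mathlib

open MvPolynomial CategoryTheory

/-- The algebra endomorphism of `ℂ[x₁,x₂]` induced by a `2 × 2` matrix `u`,
sending the variable `X i` to `∑ j, u j i • X j`. -/
noncomputable def matrixSubst (u : Matrix (Fin 2) (Fin 2) ℂ) :
    MvPolynomial (Fin 2) ℂ →ₐ[ℂ] MvPolynomial (Fin 2) ℂ :=
  aeval fun i => ∑ j, u j i • X j

/-- `matrixSubst u` preserves the homogeneous component of degree `n`. -/
theorem matrixSubst_mem (u : Matrix (Fin 2) (Fin 2) ℂ) (n : ℕ) :
    ∀ x ∈ homogeneousSubmodule (Fin 2) ℂ n,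
      matrixSubst u x ∈ homogeneousSubmodule (Fin 2) ℂ n := by
  intro x hx
  rw [← support_sum_monomial_coeff x, map_sum]
  apply Submodule.sum_mem
  intro d hd
  have hdeg : d.degree = n := by
    rw [Finsupp.degree_eq_weight_one]
    exact hx (mem_support_iff.mp hd)
  rw [mem_homogeneousSubmodule, matrixSubst, aeval_monomial, algebraMap_eq]
  apply MvPolynomial.IsHomogeneous.C_mul
  rw [Finsupp.prod]
  have : n = ∑ i ∈ d.support, d i := by
    rw [← hdeg]; rfl
  rw [this]
  apply MvPolynomial.IsHomogeneous.prod
  intro i _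
  have hL : ((∑ j, u j i • X j : MvPolynomial (Fin 2) ℂ)).IsHomogeneous 1 := by
    apply MvPolynomial.IsHomogeneous.sum
    intro j _
    rw [smul_eq_C_mul]
    exact isHomogeneous_C_mul_X _ _
  simpa using hL.pow (d i)

/-- `pₙ(u)` : the trace of the endomorphism induced by `u` on the space of homogeneous
polynomials of degree `n` in two variables (the character of `Symⁿ(ℂ²)`). -/
noncomputable def symCharacter (n : ℕ) (u : Matrix (Fin 2) (Fin 2) ℂ) : ℂ :=
  LinearMap.trace ℂ (homogeneousSubmodule (Fin 2) ℂ n)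
    ((matrixSubst u).toLinearMap.restrict (matrixSubst_mem u n))

section Characters

open scoped ComplexOrder

variable {G V : Type*} [Group G] [AddCommGroup V] [Module ℂ V]

/-- Complex conjugation of the character of a finite-dimensional representation of a finite group
amounts to inversion of the argument. -/
theorem Representation.conj_character [Finite G] [FiniteDimensional ℂ V]
    (ρ : Representation ℂ G V) (g : G) :
    (starRingEnd ℂ) (ρ.character g) = ρ.character g⁻¹ := by
  classical
  have := Fintype.ofFinite G
  let b := Module.finBasis ℂ V
  let M : G → Matrix _ _ ℂ := fun h => LinearMap.toMatrix b b (ρ h)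
  have hM : ∀ x y, M (x * y) = M x * M y := fun x y => by
    simp only [M, map_mul, LinearMap.toMatrix_mul]
  have hM1 : M 1 = 1 := by simp [M]
  have htr : ∀ h, ρ.character h = (M h).trace := fun h => LinearMap.trace_eq_matrix_trace ℂ b _
  let P : Matrix _ _ ℂ := ∑ h, (M h).conjTranspose * M h
  have hP : IsUnit P := by
    have h1 : P = 1 + ∑ h ∈ Finset.univ.erase 1, (M h).conjTranspose * M h := by
      rw [show (1 : Matrix _ _ ℂ) = (M 1).conjTranspose * M 1 by simp [hM1]]
      exact (Finset.add_sum_erase _ (fun h => (M h).conjTranspose * M h) (Finset.mem_univ 1)).symm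
    rw [h1]
    exact (Matrix.PosDef.one.add_posSemidef (Matrix.posSemidef_sum _ fun h _ =>
      Matrix.posSemidef_conjTranspose_mul_self _)).isUnit
  have hinv : (M g).conjTranspose * P * M g = P := by
    simp only [P, Finset.mul_sum, Finset.sum_mul]
    refine Fintype.sum_equiv (Equiv.mulRight g) _ _ fun h => ?_
    simp only [Equiv.coe_mulRight, hM, Matrix.conjTranspose_mul, Matrix.mul_assoc]
  have hgg : M g * M g⁻¹ = 1 := by rw [← hM, mul_inv_cancel, hM1]
  have key : (M g).conjTranspose * P = P * M g⁻¹ := by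
    rw [← hinv, Matrix.mul_assoc _ (M g), hgg, Matrix.mul_one, hinv]
  have key' : (M g).conjTranspose = P * M g⁻¹ * P⁻¹ := by
    rw [← key, Matrix.mul_nonsing_inv_cancel_right _ _ ((Matrix.isUnit_iff_isUnit_det _).1 hP)]
  rw [htr, htr, starRingEnd_apply, ← Matrix.trace_conjTranspose, key', Matrix.trace_mul_cycle,
    Matrix.nonsing_inv_mul _ ((Matrix.isUnit_iff_isUnit_det _).1 hP), Matrix.one_mul]

/-- The character of a representation is the sum of the characters of two complementary
subrepresentations. -/
theorem Representation.character_eq_add_of_isCompl [FiniteDimensional ℂ V]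
    (ρ : Representation ℂ G V) {S T : Subrepresentation ρ} (h : IsCompl S T) (g : G) :
    ρ.character g = S.toRepresentation.character g + T.toRepresentation.character g := by
  have hc : IsCompl S.toSubmodule T.toSubmodule := by
    refine IsCompl.of_eq ?_ ?_
    · rw [← Subrepresentation.toSubmodule_inf, h.inf_eq_bot]; rfl
    · rw [← Subrepresentation.toSubmodule_sup, h.sup_eq_top]; rfl
  have : ρ g = (Submodule.prodEquivOfIsCompl _ _ hc).conj
      ((S.toRepresentation g).prodMap (T.toRepresentation g)) := by
    ext v
    obtain ⟨x, rfl⟩ := (Submodule.prodEquivOfIsCompl _ _ hc).surjective v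
    simp [LinearEquiv.conj_apply, Subrepresentation.toRepresentation]
  unfold Representation.character
  rw [this, LinearMap.trace_conj', LinearMap.trace_prodMap']

end Characters

/-- The representation category object attached to an irreducible representation is simple. -/
theorem FDRep.simple_of_isIrreducible {G V : Type} [Group G] [Finite G] [AddCommGroup V]
    [Module ℂ V] [FiniteDimensional ℂ V] (ρ : Representation ℂ G V) [ρ.IsIrreducible] :
    Simple (FDRep.of ρ) := by
  have := Fintype.ofFinite G
  have : Invertible (Nat.card G : ℂ) := invertibleOfNonzero (NeZero.ne _)
  have h := Representation.char_orthonormal ρ ρ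
  rw [if_pos ⟨Representation.Equiv.refl ρ⟩, inv_mul_eq_one₀ (NeZero.ne _)] at h
  exact (FDRep.simple_iff_char_is_norm_one _).2 h.symm

/-- Every character is a linear combination of the characters of a complete family of irreducible
representations. -/
theorem Representation.exists_character_eq_sum {G : Type} [Group G] [Finite G]
    {ι : Type} [Fintype ι] (ρ : ι → FDRep ℂ G)
    (hall : ∀ V : FDRep ℂ G, Simple V → ∃ i, Nonempty (V ≅ ρ i))
    {V : Type} [AddCommGroup V] [Module ℂ V] [FiniteDimensional ℂ V]
    (π : Representation ℂ G V) :
    ∃ a : ι → ℂ, ∀ g, π.character g = ∑ j, a j * (ρ j).character g := by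
  classical
  induction hn : Module.finrank ℂ V using Nat.strong_induction_on generalizing V with
  | _ n ih =>
  by_cases hirr : π.IsIrreducible
  · obtain ⟨i, ⟨e⟩⟩ := hall _ (FDRep.simple_of_isIrreducible π)
    refine ⟨Pi.single i 1, fun g => ?_⟩
    rw [Finset.sum_eq_single i (fun j _ hj => by simp [hj]) (by simp), Pi.single_eq_same,
      one_mul, ← FDRep.char_iso e]
    rfl
  · rcases subsingleton_or_nontrivial V with hV | hV
    · refine ⟨0, fun g => ?_⟩
      have : π g = 0 := Subsingleton.elim _ _
      simp [Representation.character, this]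
    · have hnt : Nontrivial (Subrepresentation π) := by
        refine ⟨⊥, ⊤, fun h => ?_⟩
        exact bot_ne_top (congrArg Subrepresentation.toSubmodule h)
      obtain ⟨S, hS0, hS1⟩ : ∃ S : Subrepresentation π, S ≠ ⊥ ∧ S ≠ ⊤ := by
        by_contra! hS
        exact hirr ⟨fun S => or_iff_not_imp_left.2 (hS S)⟩
      obtain ⟨T, hST⟩ := exists_isCompl S
      have lt : ∀ U : Subrepresentation π, U ≠ ⊤ → Module.finrank ℂ U.toSubmodule < n := by
        intro U hU
        rw [← hn]
        exact Submodule.finrank_lt fun h => hU (Subrepresentation.toSubmodule_injective h)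
      have hT1 : T ≠ ⊤ := by
        rintro rfl
        exact hS0 (by simpa using hST.inf_eq_bot)
      obtain ⟨a, ha⟩ := ih _ (lt S hS1) S.toRepresentation rfl
      obtain ⟨b, hb⟩ := ih _ (lt T hT1) T.toRepresentation rfl
      refine ⟨a + b, fun g => ?_⟩
      rw [π.character_eq_add_of_isCompl hST, ha, hb, ← Finset.sum_add_distrib]
      simp [add_mul]

theorem matrixSubst_X (u : Matrix (Fin 2) (Fin 2) ℂ) (i : Fin 2) :
    matrixSubst u (X i) = ∑ j, u j i • X j := by
  simp [matrixSubst]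

theorem matrixSubst_mul (u v : Matrix (Fin 2) (Fin 2) ℂ) :
    matrixSubst (u * v) = (matrixSubst u).comp (matrixSubst v) := by
  ext1 i
  simp only [AlgHom.comp_apply, matrixSubst_X, Fin.sum_univ_two, map_add, map_smul,
    Matrix.mul_apply, smul_add, add_smul, smul_smul, mul_comm]
  abel

theorem matrixSubst_one : matrixSubst 1 = AlgHom.id ℂ _ := by
  ext1 i
  fin_cases i <;> simp [matrixSubst_X]

/-- The action of matrices on binary forms of degree `n`, as a monoid homomorphism. -/
noncomputable def symHom (n : ℕ) : Matrix (Fin 2) (Fin 2) ℂ →*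
    Module.End ℂ (homogeneousSubmodule (Fin 2) ℂ n) where
  toFun u := (matrixSubst u).toLinearMap.restrict (matrixSubst_mem u n)
  map_one' := by
    ext1 x
    simp [Subtype.ext_iff, matrixSubst_one]
  map_mul' u v := by
    ext1 x
    refine Subtype.ext ?_
    simp [matrixSubst_mul]
    rfl

theorem symCharacter_eq_trace (n : ℕ) (u : Matrix (Fin 2) (Fin 2) ℂ) :
    symCharacter n u = LinearMap.trace ℂ _ (symHom n u) := rfl

/-- The trace of the action on binary forms is invariant under conjugation. -/
theorem symCharacter_conj (n : ℕ) {P Q : Matrix (Fin 2) (Fin 2) ℂ} (h : P * Q = 1)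
    (u : Matrix (Fin 2) (Fin 2) ℂ) : symCharacter n (Q * u * P) = symCharacter n u := by
  rw [symCharacter_eq_trace, map_mul, LinearMap.trace_mul_comm, ← map_mul, ← mul_assoc, h,
    one_mul, symCharacter_eq_trace]

/-- The monomial basis of the space of binary forms of degree `n`. -/
noncomputable def binaryFormBasis (n : ℕ) :
    Module.Basis {d : Fin 2 →₀ ℕ // d.degree = n} ℂ (homogeneousSubmodule (Fin 2) ℂ n) :=
  .ofRepr ((LinearEquiv.ofEq _ _ (homogeneousSubmodule_eq_finsupp_supported _ _ n)).trans
    (AddMonoidAlgebra.supportedEquivFinsupp {d : Fin 2 →₀ ℕ | d.degree = n}))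

theorem binaryFormBasis_repr (n : ℕ) (p d) :
    (binaryFormBasis n).repr p d = coeff d.1 (p : MvPolynomial (Fin 2) ℂ) := rfl

theorem coe_binaryFormBasis (n : ℕ) (d) :
    ((binaryFormBasis n d : homogeneousSubmodule (Fin 2) ℂ n) : MvPolynomial (Fin 2) ℂ) =
      monomial d.1 1 := by
  ext e
  by_cases he : e.degree = n
  · rw [← binaryFormBasis_repr n _ ⟨e, he⟩, Module.Basis.repr_self, coeff_monomial,
      Finsupp.single_apply]
    simp [Subtype.ext_iff]
  · rw [coeff_monomial, if_neg (by rintro rfl; exact he d.2)]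
    by_contra h
    have := (binaryFormBasis n d).2 h
    exact he (by rwa [Finsupp.degree_eq_weight_one])

/-- Exponent vectors of binary monomials of degree `n` are pairs of naturals with sum `n`. -/
noncomputable def binaryExponentEquiv (n : ℕ) :
    Finset.HasAntidiagonal.antidiagonal n ≃ {d : Fin 2 →₀ ℕ // d.degree = n} where
  toFun p := ⟨Finsupp.equivFunOnFinite.symm ![p.1.1, p.1.2], by
    simpa [Finsupp.degree_eq_sum] using Finset.HasAntidiagonal.mem_antidiagonal.1 p.2⟩
  invFun d := ⟨(d.1 0, d.1 1), by simpa [Finsupp.degree_eq_sum] using d.2⟩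
  left_inv p := by simp
  right_inv d := by
    ext i
    fin_cases i <;> simp

theorem coeff_linear_pow_mul (a b d : ℂ) (i j : ℕ) (e : Fin 2 →₀ ℕ) (h0 : e 0 = i)
    (h1 : e 1 = j) :
    coeff e ((a • X 0) ^ i * (b • X 0 + d • X 1) ^ j : MvPolynomial (Fin 2) ℂ) = a ^ i * d ^ j := by
  have he : e = Finsupp.single 1 j + Finsupp.single 0 i := by
    ext k
    fin_cases k <;> simp [h0, h1]
  have hX : (a • X 0 : MvPolynomial (Fin 2) ℂ) ^ i = monomial (Finsupp.single 0 i) (a ^ i) := by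
    rw [smul_pow, X_pow_eq_monomial, smul_monomial, smul_eq_mul, mul_one]
  rw [he, hX, add_comm, coeff_monomial_mul]
  congr 1
  clear h0 h1 he hX
  induction j with
  | zero => simp
  | succ j ih =>
    rw [pow_succ, mul_add, mul_smul_comm, mul_smul_comm, coeff_add, coeff_smul, coeff_smul,
      coeff_mul_X', if_neg (by simp), Finsupp.single_add, coeff_mul_X, ih, pow_succ]
    simp [mul_comm]

/-- The trace of an upper triangular matrix on binary forms. -/
theorem symCharacter_triangular (n : ℕ) (u : Matrix (Fin 2) (Fin 2) ℂ) (hu : u 1 0 = 0) :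
    symCharacter n u = ∑ p ∈ Finset.HasAntidiagonal.antidiagonal n, u 0 0 ^ p.1 * u 1 1 ^ p.2 := by
  classical
  rw [symCharacter_eq_trace,
    LinearMap.trace_eq_matrix_trace ℂ ((binaryFormBasis n).reindex (binaryExponentEquiv n).symm),
    Matrix.trace, ← Finset.sum_coe_sort (Finset.HasAntidiagonal.antidiagonal n)]
  refine Finset.sum_congr rfl fun (p : Finset.HasAntidiagonal.antidiagonal n) _ => ?_
  rw [Matrix.diag_apply, LinearMap.toMatrix_apply, Module.Basis.reindex_apply,
    Module.Basis.repr_reindex_apply, binaryFormBasis_repr]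
  change coeff _ (matrixSubst u (binaryFormBasis n _ : MvPolynomial (Fin 2) ℂ)) = _
  rw [coe_binaryFormBasis, monomial_eq, Finsupp.prod_fintype _ _ (by simp)]
  simp only [map_one, one_mul, Fin.prod_univ_two, map_mul, map_pow, matrixSubst_X,
    Fin.sum_univ_two, hu, zero_smul, add_zero]
  exact coeff_linear_pow_mul _ _ _ _ _ _ rfl rfl

theorem sum_antidiagonal_recurrence (a d : ℂ) (h : a * d = 1) (n : ℕ) :
    (a + d) * ∑ p ∈ Finset.HasAntidiagonal.antidiagonal (n + 1), a ^ p.1 * d ^ p.2 =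
      ∑ p ∈ Finset.HasAntidiagonal.antidiagonal n, a ^ p.1 * d ^ p.2 +
      ∑ p ∈ Finset.HasAntidiagonal.antidiagonal (n + 2), a ^ p.1 * d ^ p.2 := by
  have h2 : ∀ m, ∑ p ∈ Finset.HasAntidiagonal.antidiagonal (m + 1), a ^ p.1 * d ^ p.2 =
      d ^ (m + 1) + (∑ p ∈ Finset.HasAntidiagonal.antidiagonal m, a ^ p.1 * d ^ p.2) * a := by
    intro m
    rw [Finset.Nat.sum_antidiagonal_succ, Finset.sum_mul]
    simp only [pow_zero, one_mul, pow_succ a, mul_right_comm _ a]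
  simp only [h2 (n + 1), h2 n]
  linear_combination
    (∑ p ∈ Finset.HasAntidiagonal.antidiagonal n, a ^ p.1 * d ^ p.2) * h

theorem exists_triangular (u : Matrix (Fin 2) (Fin 2) ℂ) :
    ∃ P Q : Matrix (Fin 2) (Fin 2) ℂ, P * Q = 1 ∧ (Q * u * P) 1 0 = 0 := by
  by_cases hu : u 1 0 = 0
  · exact ⟨1, 1, by simp, by simpa using hu⟩
  · obtain ⟨x, hx⟩ := exists_quadratic_eq_zero (b := u 1 1 - u 0 0) (c := -u 0 1) hu
      (IsAlgClosed.exists_eq_mul_self _)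
    refine ⟨!![x, -1; 1, 0], !![0, 1; -1, x], ?_, ?_⟩
    · ext i j
      fin_cases i <;> fin_cases j <;> simp [Matrix.mul_apply]
    · simp only [Matrix.mul_apply, Fin.sum_univ_two]
      simp
      linear_combination hx

/-- The Clebsch–Gordan relation for the characters of the symmetric powers. -/
theorem symCharacter_one_mul (n : ℕ) (u : Matrix (Fin 2) (Fin 2) ℂ) (hu : u.det = 1) :
    symCharacter 1 u * symCharacter (n + 1) u = symCharacter n u + symCharacter (n + 2) u := by
  obtain ⟨P, Q, hPQ, ht⟩ := exists_triangular u
  have hdet : (Q * u * P).det = 1 := by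
    rw [Matrix.det_mul_comm, ← Matrix.mul_assoc, hPQ, Matrix.one_mul, hu]
  rw [Matrix.det_fin_two, ht, mul_zero, sub_zero] at hdet
  simp only [← symCharacter_conj _ hPQ u, symCharacter_triangular _ _ ht]
  rw [← sum_antidiagonal_recurrence _ _ hdet]
  congr 1
  simp [Finset.Nat.antidiagonal_succ, add_comm]

/-- The `n`-th symmetric power of the standard representation, restricted along `φ`. -/
noncomputable def symRep {G : Type*} [Group G] (φ : G →* Matrix.SpecialLinearGroup (Fin 2) ℂ)
    (n : ℕ) : Representation ℂ G (homogeneousSubmodule (Fin 2) ℂ n) where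
  toFun g := symHom n (φ g)
  map_one' := by simp
  map_mul' g h := by simp

theorem symRep_character {G : Type*} [Group G] (φ : G →* Matrix.SpecialLinearGroup (Fin 2) ℂ)
    (n : ℕ) (g : G) : (symRep φ n).character g = symCharacter n (φ g) := rfl

/-- Kostant's relation for the McKay operator: `B vₙ = v_{n-1} + v_{n+1}`.
For a finite group `G` with a homomorphism `φ : G →* SL(2,ℂ)`, letting `cₙ` be the
character of the restriction to `G` of the `n`-th symmetric power representation `πₙ`
of `SL(2,ℂ)`, `(ρ_i)` a complete family of pairwise non-isomorphic irreducible
representations of `G` with characters `χ_i`, `A i j = ⟨c₁ ⬝ χ_j, χ_i⟩` the McKay matrix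
and `m_i(n) = ⟨cₙ, χ_i⟩` the multiplicities, one has
`∑ j, A i j * m_j(n) = m_i(n-1) + m_i(n+1)` for all `n ≥ 1`. -/
theorem mckay_operator_relation (G : Type) [Group G] [Fintype G]
    (φ : G →* Matrix.SpecialLinearGroup (Fin 2) ℂ)
    (ι : Type) [Fintype ι] (ρ : ι → FDRep ℂ G)
    (hsimple : ∀ i, Simple (ρ i))
    (hdist : ∀ i j, i ≠ j → ¬ Nonempty (ρ i ≅ ρ j))
    (hall : ∀ V : FDRep ℂ G, Simple V → ∃ i, Nonempty (V ≅ ρ i))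
    (c : ℕ → G → ℂ)
    (hc : ∀ n g, c n g = symCharacter n ((φ g : Matrix (Fin 2) (Fin 2) ℂ)))
    (A : Matrix ι ι ℂ)
    (hA : ∀ i j, A i j = (1 / (Fintype.card G : ℂ)) *
      ∑ g : G, (c 1 g * (ρ j).character g) * (starRingEnd ℂ) ((ρ i).character g))
    (m : ι → ℕ → ℂ)
    (hm : ∀ i n, m i n = (1 / (Fintype.card G : ℂ)) *
      ∑ g : G, c n g * (starRingEnd ℂ) ((ρ i).character g)) :
    ∀ n, 1 ≤ n → ∀ i, ∑ j, A i j * m j n = m i (n - 1) + m i (n + 1) := by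
  classical
  intro n hn i
  obtain ⟨n, rfl⟩ := Nat.exists_eq_add_of_le' hn
  have : Invertible (Nat.card G : ℂ) := invertibleOfNonzero (NeZero.ne _)
  have hfin : FiniteDimensional ℂ (homogeneousSubmodule (Fin 2) ℂ (n + 1)) :=
    Module.Finite.iff_fg.2 (homogeneousSubmodule_fg _ _ _)
  have hconj : ∀ j g, (starRingEnd ℂ) ((ρ j).character g) = (ρ j).character g⁻¹ :=
    fun j g => Representation.conj_character (ρ j).ρ g
  obtain ⟨a, ha⟩ := Representation.exists_character_eq_sum ρ hall (symRep φ (n + 1))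
  have hc' : ∀ g, c (n + 1) g = ∑ j, a j * (ρ j).character g := fun g => by
    rw [hc, ← symRep_character, ha]
  have horth : ∀ j k, (1 / (Fintype.card G : ℂ)) *
      ∑ g : G, (ρ k).character g * (ρ j).character g⁻¹ = if k = j then 1 else 0 := by
    intro j k
    have := hsimple j
    have := hsimple k
    rw [one_div, Fintype.card_eq_nat_card, FDRep.char_orthonormal]
    refine if_congr ⟨fun h => ?_, ?_⟩ rfl rfl
    · by_contra hkj
      exact hdist k j hkj h
    · rintro rfl
      exact ⟨Iso.refl _⟩
  have hma : ∀ j, m j (n + 1) = a j := by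
    intro j
    simp only [hm, hconj, hc', Finset.sum_mul, mul_assoc]
    rw [Finset.sum_comm]
    simp only [← Finset.mul_sum]
    rw [Finset.mul_sum]
    simp only [mul_left_comm _ (a _), horth]
    simp
  simp only [hma, hA, Nat.add_sub_cancel]
  rw [hm, hm, ← mul_add, ← Finset.sum_add_distrib]
  simp only [← add_mul]
  have hrec : ∀ g, c n g + c (n + 1 + 1) g = c 1 g * ∑ j, a j * (ρ j).character g := by
    intro g
    rw [← hc', hc, hc, hc, hc, symCharacter_one_mul n _ (φ g).2]
  simp only [hrec, mul_assoc, ← Finset.mul_sum, Finset.sum_mul]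
  simp only [Finset.mul_sum]
  rw [Finset.sum_comm]
  refine Finset.sum_congr rfl fun g _ => Finset.sum_congr rfl fun j _ => ?_
  ring
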